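/- Fix cog ∈ C with cog > cog*. Let V : ℤ × C → ℝ satisfy the value-bound property with constants t_s, t_max, ρ. Assume t_s < E[τ|cog,R] < E[τ|cog,N] < E[τ|cog,H] and that E[τ|cog,R] − t_s + t_s·γ^{E[τ|cog,H]}/(1 − γ^{t_max}) ≥ γ^{t_s}·t_max/(1−ρ). Then for each a ∈ {R, N, H} the map q ↦ Q_V(q,cog,S) − Q_V(q,cog,a) is nondecreasing on ℤ; consequently, if Q_V(q₁,cog,S) > Q_V(q₁,cog,a) for all a ∈ {R,N,H} at some q₁, then the same strict inequalities hold at every q₂ ≥ q₁, i.e., there is a threshold q₃*(cog) above which action S is optimal among {S, R, N, H}. -/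

import Mathlib

open scoped BigOperators

namespace Fidelity

/-- The actions available to the human operator: skip, rest, normal fidelity, high fidelity. -/
inductive Action : Type
  | S | R | N | H
deriving DecidableEq

/-- Admissible action set: `{S, N, H}` for `cog ≤ cog*` and `{S, R, N, H}` for `cog > cog*`. -/
def Act {C : Type*} [LinearOrder C] (cogStar cog : C) : Finset Action :=
  if cog ≤ cogStar then {Action.S, Action.N, Action.H}
  else {Action.S, Action.R, Action.N, Action.H}

lemma Act_nonempty {C : Type*} [LinearOrder C] (cogStar cog : C) :
    (Act cogStar cog).Nonempty := by
  unfold Act; split <;> exact ⟨Action.S, by simp⟩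

/-- The reward `r(a)`: `r(H) = r_H`, `r(N) = r_N`, `r(S) = r(R) = 0`. -/
noncomputable def rew (rH rN : ℝ) : Action → ℝ
  | Action.H => rH
  | Action.N => rN
  | _ => 0

/-- Expected net immediate reward
`R((q,cog),a) = r(a) − c·E[τ|cog,a]·q − (cλ/2)·E[τ²|cog,a]`. -/
noncomputable def Rimm {C : Type*} (c lam rH rN : ℝ) (Etau Etau2 : C → Action → ℝ)
    (q : ℤ) (cog : C) (a : Action) : ℝ :=
  rew rH rN a - c * Etau cog a * (q : ℝ) - c * lam / 2 * Etau2 cog a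

/-- The Poisson probability of `w` arrivals when the mean number of arrivals is `μ`. -/
noncomputable def poissonPMF (μ : ℝ) (w : ℕ) : ℝ :=
  Real.exp (-μ) * μ ^ w / (w.factorial : ℝ)

/-- The next queue length: `q − 1 + w` under actions `S, N, H` and `q + w` under `R`. -/
def nextQ (a : Action) (q : ℤ) (w : ℕ) : ℤ :=
  if a = Action.R then q + (w : ℤ) else q - 1 + (w : ℤ)

/-- `E[γ^τ | cog, a]`, the expected discount over a sojourn in state `cog` under action `a`. -/
noncomputable def Egamma {C : Type*} [Fintype C] (γ : ℝ) (P : C → Action → ℕ → C → ℝ)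
    (cog : C) (a : Action) : ℝ :=
  ∑' (τ : ℕ), ∑' (cog' : C), γ ^ τ * P cog a τ cog'

/-- The Q-value of action `a` at `(q, cog)` for the continuation value function `V`:
`Q_V(q,cog,a) = R((q,cog),a) + Σ_{τ,cog',w} γ^τ·P(τ,cog'|cog,a)·Poisson(λτ)(w)·V(q',cog')`. -/
noncomputable def Qval {C : Type*} [Fintype C] (c lam rH rN γ : ℝ)
    (Etau Etau2 : C → Action → ℝ) (P : C → Action → ℕ → C → ℝ)
    (V : ℤ → C → ℝ) (q : ℤ) (cog : C) (a : Action) : ℝ :=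
  Rimm c lam rH rN Etau Etau2 q cog a +
    ∑' (τ : ℕ), ∑' (cog' : C), ∑' (w : ℕ),
      γ ^ τ * P cog a τ cog' * poissonPMF (lam * (τ : ℝ)) w * V (nextQ a q w) cog'

/-- `V` satisfies the value-bound property with constants `t_s`, `t_max`, `ρ`:
for all `cog'`, `q` and `Δ ∈ ℕ`,
`c·t_s·Δ/(1 − γ^{t_max}) ≤ V(q,cog') − V(q+Δ,cog') ≤ c·t_max·Δ/(1 − ρ)`. -/
def ValueBound {C : Type*} (c γ ρ : ℝ) (ts tmax : ℕ) (V : ℤ → C → ℝ) : Prop :=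
  ∀ (cog' : C) (q : ℤ) (Δ : ℕ),
    c * (ts : ℝ) * (Δ : ℝ) / (1 - γ ^ tmax) ≤ V q cog' - V (q + (Δ : ℤ)) cog' ∧
    V q cog' - V (q + (Δ : ℤ)) cog' ≤ c * (tmax : ℝ) * (Δ : ℝ) / (1 - ρ)

/-- The discounted expectation of `f w cog'` over the sojourn time, the next cognitive state and
the number `w` of arrivals. -/
noncomputable def discountedMean {C : Type*} [Fintype C] (lam γ : ℝ) (p : ℕ → C → ℝ)
    (f : ℕ → C → ℝ) : ℝ :=
  ∑' (τ : ℕ), ∑' (cog' : C), ∑' (w : ℕ),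
    γ ^ τ * p τ cog' * poissonPMF (lam * (τ : ℝ)) w * f w cog'

lemma poissonPMF_nonneg {μ : ℝ} (hμ : 0 ≤ μ) (w : ℕ) : 0 ≤ poissonPMF μ w := by
  unfold poissonPMF; positivity

lemma hasSum_poissonPMF (μ : ℝ) : HasSum (poissonPMF μ) 1 := by
  have h := (NormedSpace.expSeries_div_hasSum_exp μ).mul_left (Real.exp (-μ))
  rw [← Real.exp_eq_exp_ℝ, ← Real.exp_add, neg_add_cancel, Real.exp_zero] at h
  exact h.congr_fun fun w => by simp only [poissonPMF, mul_div_assoc]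

lemma hasSum_poissonPMF_mul_id (μ : ℝ) : HasSum (fun w : ℕ => poissonPMF μ w * w) μ := by
  have h := (hasSum_poissonPMF μ).mul_left μ
  rw [mul_one] at h
  have h' : HasSum (fun w : ℕ => poissonPMF μ (w + 1) * ((w + 1 : ℕ) : ℝ)) μ := by
    refine h.congr_fun fun w => ?_
    have : (w.factorial : ℝ) ≠ 0 := by positivity
    have : (w : ℝ) + 1 ≠ 0 := by positivity
    simp only [poissonPMF, Nat.factorial_succ, pow_succ]
    push_cast
    field_simp
  simpa using (hasSum_nat_add_iff (f := fun w : ℕ => poissonPMF μ w * w) 1).1 h'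

lemma hasSum_poissonPMF_mul_affine (μ A B : ℝ) :
    HasSum (fun w : ℕ => poissonPMF μ w * (A + B * w)) (A + B * μ) := by
  have h := ((hasSum_poissonPMF μ).mul_left A).add ((hasSum_poissonPMF_mul_id μ).mul_left B)
  rw [mul_one] at h
  exact h.congr_fun fun w => by ring

lemma summable_poissonPMF_mul {μ A B : ℝ} (hμ : 0 ≤ μ) {f : ℕ → ℝ}
    (hf : ∀ w, |f w| ≤ A + B * w) : Summable fun w => poissonPMF μ w * f w := by
  refine Summable.of_norm_bounded (hasSum_poissonPMF_mul_affine μ A B).summable fun w => ?_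
  rw [Real.norm_eq_abs, abs_mul, abs_of_nonneg (poissonPMF_nonneg hμ w)]
  exact mul_le_mul_of_nonneg_left (hf w) (poissonPMF_nonneg hμ w)

lemma abs_tsum_poissonPMF_mul_le {μ A B : ℝ} (hμ : 0 ≤ μ) {f : ℕ → ℝ}
    (hf : ∀ w, |f w| ≤ A + B * w) : |∑' w, poissonPMF μ w * f w| ≤ A + B * μ := by
  rw [← Real.norm_eq_abs]
  refine tsum_of_norm_bounded (hasSum_poissonPMF_mul_affine μ A B) fun w => ?_
  rw [Real.norm_eq_abs, abs_mul, abs_of_nonneg (poissonPMF_nonneg hμ w)]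
  exact mul_le_mul_of_nonneg_left (hf w) (poissonPMF_nonneg hμ w)

lemma tsum_poissonPMF_mul_add_le {μ A B A' B' L : ℝ} (hμ : 0 ≤ μ) {f g : ℕ → ℝ}
    (hf : ∀ w, |f w| ≤ A + B * w) (hg : ∀ w, |g w| ≤ A' + B' * w)
    (hL : ∀ w, g w + L ≤ f w) :
    (∑' w, poissonPMF μ w * g w) + L ≤ ∑' w, poissonPMF μ w * f w := by
  have h := (summable_poissonPMF_mul hμ hg).hasSum.add ((hasSum_poissonPMF μ).mul_right L)
  rw [one_mul] at h
  refine hasSum_le (fun w => ?_) h (summable_poissonPMF_mul hμ hf).hasSum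
  rw [← mul_add]
  exact mul_le_mul_of_nonneg_left (hL w) (poissonPMF_nonneg hμ w)

section discountedMean

variable {C : Type*} [Fintype C] {lam γ : ℝ} {p : ℕ → C → ℝ}

lemma discountedMean_eq (f : ℕ → C → ℝ) :
    discountedMean lam γ p f = ∑' τ : ℕ, ∑ cog' : C, γ ^ τ * p τ cog' *
      ∑' w, poissonPMF (lam * (τ : ℝ)) w * f w cog' := by
  simp only [discountedMean, tsum_fintype, mul_assoc, tsum_mul_left]

lemma summable_discountedMean (hlam : 0 ≤ lam) (hγ₀ : 0 ≤ γ) (hγ₁ : γ ≤ 1)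
    (hp : ∀ τ cog', 0 ≤ p τ cog')
    (hs0 : Summable fun τ => ∑ cog', p τ cog')
    (hs1 : Summable fun τ : ℕ => (τ : ℝ) * ∑ cog', p τ cog')
    {f : ℕ → C → ℝ} {A B : ℝ} (hf : ∀ w cog', |f w cog'| ≤ A + B * w) :
    Summable fun τ : ℕ => ∑ cog' : C, γ ^ τ * p τ cog' *
      ∑' w, poissonPMF (lam * (τ : ℝ)) w * f w cog' := by
  refine Summable.of_norm_bounded ((hs0.mul_left A).add (hs1.mul_left (B * lam))) fun τ => ?_
  have hμ : 0 ≤ lam * (τ : ℝ) := by positivity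
  calc ‖∑ cog' : C, γ ^ τ * p τ cog' * ∑' w, poissonPMF (lam * (τ : ℝ)) w * f w cog'‖
      ≤ ∑ cog' : C, p τ cog' * (A + B * (lam * τ)) := by
        refine norm_sum_le_of_le _ fun cog' _ => ?_
        rw [norm_mul, Real.norm_eq_abs, Real.norm_eq_abs,
          abs_of_nonneg (mul_nonneg (pow_nonneg hγ₀ τ) (hp τ cog'))]
        exact mul_le_mul (mul_le_of_le_one_left (hp τ cog') (pow_le_one₀ hγ₀ hγ₁))
          (abs_tsum_poissonPMF_mul_le hμ fun w => hf w cog') (abs_nonneg _) (hp τ cog')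
    _ = A * ∑ cog', p τ cog' + B * lam * ((τ : ℝ) * ∑ cog', p τ cog') := by
        rw [← Finset.sum_mul]; ring

lemma summable_discount (hγ₀ : 0 ≤ γ) (hγ₁ : γ ≤ 1)
    (hp : ∀ τ cog', 0 ≤ p τ cog') (hs0 : Summable fun τ => ∑ cog', p τ cog') :
    Summable fun τ => γ ^ τ * ∑ cog', p τ cog' :=
  Summable.of_nonneg_of_le
    (fun τ => mul_nonneg (pow_nonneg hγ₀ τ) (Finset.sum_nonneg fun cog' _ => hp τ cog'))
    (fun τ => mul_le_of_le_one_left (Finset.sum_nonneg fun cog' _ => hp τ cog')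
      (pow_le_one₀ hγ₀ hγ₁)) hs0

lemma discountedMean_add_le (hlam : 0 ≤ lam) (hγ₀ : 0 ≤ γ) (hγ₁ : γ ≤ 1)
    (hp : ∀ τ cog', 0 ≤ p τ cog')
    (hs0 : Summable fun τ => ∑ cog', p τ cog')
    (hs1 : Summable fun τ : ℕ => (τ : ℝ) * ∑ cog', p τ cog')
    {f g : ℕ → C → ℝ} {A B A' B' L : ℝ} (hf : ∀ w cog', |f w cog'| ≤ A + B * w)
    (hg : ∀ w cog', |g w cog'| ≤ A' + B' * w) (hL : ∀ w cog', g w cog' + L ≤ f w cog') :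
    discountedMean lam γ p g + L * ∑' τ, γ ^ τ * ∑ cog', p τ cog' ≤ discountedMean lam γ p f := by
  rw [discountedMean_eq, discountedMean_eq]
  refine hasSum_le (fun τ => ?_)
    ((summable_discountedMean hlam hγ₀ hγ₁ hp hs0 hs1 hg).hasSum.add
      ((summable_discount hγ₀ hγ₁ hp hs0).hasSum.mul_left L))
    (summable_discountedMean hlam hγ₀ hγ₁ hp hs0 hs1 hf).hasSum
  have hμ : 0 ≤ lam * (τ : ℝ) := by positivity
  calc _ = ∑ cog' : C, γ ^ τ * p τ cog' *
        ((∑' w, poissonPMF (lam * (τ : ℝ)) w * g w cog') + L) := by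
        simp only [mul_add, Finset.sum_add_distrib, ← Finset.sum_mul, ← Finset.mul_sum]
        ring
    _ ≤ _ := Finset.sum_le_sum fun cog' _ => mul_le_mul_of_nonneg_left
        (tsum_poissonPMF_mul_add_le hμ (fun w => hf w cog') (fun w => hg w cog')
          fun w => hL w cog') (mul_nonneg (pow_nonneg hγ₀ τ) (hp τ cog'))

end discountedMean

/-- Jensen's inequality for the convex function `x ↦ γ ^ x`. -/
lemma rpow_mean_le_tsum {γ : ℝ} (hγ₀ : 0 < γ) (hγ₁ : γ ≤ 1) {m : ℕ → ℝ} (hm : ∀ τ, 0 ≤ m τ)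
    (h0 : HasSum m 1) {E : ℝ} (h1 : HasSum (fun τ : ℕ => (τ : ℝ) * m τ) E) :
    γ ^ E ≤ ∑' τ, γ ^ τ * m τ := by
  have hs : Summable fun τ => γ ^ τ * m τ :=
    Summable.of_nonneg_of_le (fun τ => mul_nonneg (pow_nonneg hγ₀.le τ) (hm τ))
      (fun τ => mul_le_of_le_one_left (hm τ) (pow_le_one₀ hγ₀.le hγ₁)) h0.summable
  have h := ((h0.mul_left (1 - E * Real.log γ)).add (h1.mul_left (Real.log γ))).mul_left (γ ^ E)
  have hE : γ ^ E * ((1 - E * Real.log γ) * 1 + Real.log γ * E) = γ ^ E := by ring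
  rw [hE] at h
  refine hasSum_le (fun τ => ?_) h hs.hasSum
  have hsplit : γ ^ τ = γ ^ E * Real.exp (Real.log γ * (τ - E)) := by
    rw [Real.rpow_def_of_pos hγ₀, ← Real.exp_add, ← Real.rpow_natCast, Real.rpow_def_of_pos hγ₀]
    ring_nf
  have hexp := Real.add_one_le_exp (Real.log γ * (τ - E))
  rw [hsplit, mul_assoc]
  refine mul_le_mul_of_nonneg_left ?_ (Real.rpow_nonneg hγ₀.le E)
  calc _ = (Real.log γ * (τ - E) + 1) * m τ := by ring
    _ ≤ _ := mul_le_mul_of_nonneg_right hexp (hm τ)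

lemma Qval_eq {C : Type*} [Fintype C] (c lam rH rN γ : ℝ)
    (Etau Etau2 : C → Action → ℝ) (P : C → Action → ℕ → C → ℝ)
    (V : ℤ → C → ℝ) (q : ℤ) (cog : C) (a : Action) :
    Qval c lam rH rN γ Etau Etau2 P V q cog a = Rimm c lam rH rN Etau Etau2 q cog a +
      discountedMean lam γ (P cog a) fun w => V (nextQ a q w) := rfl

lemma nextQ_eq (a : Action) (q : ℤ) (w : ℕ) : nextQ a q w = nextQ a q 0 + w := by
  unfold nextQ; split <;> simp

lemma nextQ_add (a : Action) (q : ℤ) (Δ : ℕ) (w : ℕ) :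
    nextQ a (q + Δ) w = nextQ a q w + Δ := by
  unfold nextQ; split <;> ring

lemma ValueBound.abs_apply_add_le {C : Type*} [Fintype C] {c γ ρ : ℝ} {ts tmax : ℕ} {V : ℤ → C → ℝ}
    (hV : ValueBound c γ ρ ts tmax V) (hc : 0 ≤ c) (hγ₀ : 0 ≤ γ) (hγ₁ : γ ≤ 1)
    (q : ℤ) (w : ℕ) (cog' : C) :
    |V (q + w) cog'| ≤ (∑ x, |V q x|) + c * tmax / (1 - ρ) * w := by
  have h := hV cog' q w
  have h0 : 0 ≤ c * (ts : ℝ) * (w : ℝ) / (1 - γ ^ tmax) :=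
    div_nonneg (by positivity) (sub_nonneg.2 (pow_le_one₀ hγ₀ hγ₁))
  have h1 : |V q cog'| ≤ ∑ x, |V q x| :=
    Finset.single_le_sum (f := fun x => |V q x|) (fun x _ => abs_nonneg _) (Finset.mem_univ cog')
  have h2 : c * (tmax : ℝ) * w / (1 - ρ) = c * tmax / (1 - ρ) * w := by ring
  rw [abs_le] at *
  constructor <;> linarith [h.1, h.2, h1.1, h1.2]

/-- Raising the queue length by `Δ` lowers the Q-value by an amount controlled by the expected
sojourn time and the expected discount. -/
lemma Qval_sub_bounds {C : Type*} [Fintype C] {c lam rH rN γ ρ : ℝ} {ts tmax : ℕ}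
    {Etau Etau2 : C → Action → ℝ} {P : C → Action → ℕ → C → ℝ} {V : ℤ → C → ℝ}
    (hV : ValueBound c γ ρ ts tmax V) (hc : 0 ≤ c) (hlam : 0 ≤ lam) (hγ₀ : 0 ≤ γ) (hγ₁ : γ ≤ 1)
    {cog : C} {a : Action} (hp : ∀ τ cog', 0 ≤ P cog a τ cog')
    (hs0 : Summable fun τ => ∑ cog', P cog a τ cog')
    (hs1 : Summable fun τ : ℕ => (τ : ℝ) * ∑ cog', P cog a τ cog') (q : ℤ) (Δ : ℕ) :
    c * Etau cog a * Δ + c * ts * Δ / (1 - γ ^ tmax) * ∑' τ, γ ^ τ * ∑ cog', P cog a τ cog' ≤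
        Qval c lam rH rN γ Etau Etau2 P V q cog a -
          Qval c lam rH rN γ Etau Etau2 P V (q + Δ) cog a ∧
      Qval c lam rH rN γ Etau Etau2 P V q cog a -
          Qval c lam rH rN γ Etau Etau2 P V (q + Δ) cog a ≤
        c * Etau cog a * Δ + c * tmax * Δ / (1 - ρ) * ∑' τ, γ ^ τ * ∑ cog', P cog a τ cog' := by
  have hgrow (q : ℤ) (w : ℕ) (cog' : C) := by
    simpa only [← nextQ_eq] using hV.abs_apply_add_le hc hγ₀ hγ₁ (nextQ a q 0) w cog'
  have hlow := discountedMean_add_le (L := c * ts * Δ / (1 - γ ^ tmax)) hlam hγ₀ hγ₁ hp hs0 hs1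
    (hgrow q) (hgrow (q + Δ)) fun w cog' => by
      rw [nextQ_add]; linarith [(hV cog' (nextQ a q w) Δ).1]
  have hupp := discountedMean_add_le (L := -(c * tmax * Δ / (1 - ρ))) hlam hγ₀ hγ₁ hp hs0 hs1
    (hgrow (q + Δ)) (hgrow q) fun w cog' => by
      rw [nextQ_add]; linarith [(hV cog' (nextQ a q w) Δ).2]
  simp only [Qval_eq, Rimm]
  push_cast
  constructor <;> nlinarith [hlow, hupp]

/-- for `cog > cog*`, if `V` satisfies the value-bound property,
`t_s < E[τ|cog,R] < E[τ|cog,N] < E[τ|cog,H]`, and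
`E[τ|cog,R] − t_s + t_s·γ^{E[τ|cog,H]}/(1−γ^{t_max}) ≥ γ^{t_s}·t_max/(1−ρ)`,
then for each `a ∈ {R,N,H}` the map `q ↦ Q_V(q,cog,S) − Q_V(q,cog,a)` is nondecreasing;
consequently once `S` strictly dominates all of `R`, `N`, `H` it does so for all larger
queue lengths. -/
theorem stmt13 {C : Type*} [LinearOrder C] [Fintype C]
    (cogStar : C) (c lam rH rN γ : ℝ) (ts : ℕ)
    (Etau Etau2 : C → Action → ℝ) (P : C → Action → ℕ → C → ℝ)
    (hc : 0 < c) (hlam : 0 < lam) (hγ : γ ∈ Set.Ioo (0 : ℝ) 1)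
    (hrN : 0 ≤ rN) (hrHN : rN < rH) (hts : 1 ≤ ts)
    (hPnn : ∀ cog a τ cog', 0 ≤ P cog a τ cog')
    (hP0 : ∀ cog a cog', P cog a 0 cog' = 0)
    (hPsum : ∀ cog, ∀ a ∈ Act cogStar cog, (∑' (τ : ℕ), ∑' (cog' : C), P cog a τ cog') = 1)
    (hPS : ∀ cog τ cog', τ ≠ ts → P cog Action.S τ cog' = 0)
    (hEtau : ∀ cog a, Etau cog a = ∑' (τ : ℕ), ∑' (cog' : C), (τ : ℝ) * P cog a τ cog')
    (hEtau2 : ∀ cog a, Etau2 cog a = ∑' (τ : ℕ), ∑' (cog' : C), (τ : ℝ) ^ 2 * P cog a τ cog')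
    (hMom2 : ∀ cog a, Summable fun τ : ℕ => (τ : ℝ) ^ 2 * ∑' (cog' : C), P cog a τ cog')
    (tmax : ℕ) (htmax : 1 ≤ tmax) (ρ : ℝ) (hρ : ρ ∈ Set.Ioo (0 : ℝ) 1)
    (hEle : ∀ cog, ∀ a ∈ Act cogStar cog, Etau cog a ≤ (tmax : ℝ))
    (cog : C) (hcog : cogStar < cog)
    (V : ℤ → C → ℝ) (hV : ValueBound c γ ρ ts tmax V)
    (hord : (ts : ℝ) < Etau cog Action.R ∧ Etau cog Action.R < Etau cog Action.N ∧
      Etau cog Action.N < Etau cog Action.H)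
    (hcond : Etau cog Action.R - (ts : ℝ)
          + (ts : ℝ) * γ ^ Etau cog Action.H / (1 - γ ^ tmax)
        ≥ γ ^ ts * ((tmax : ℝ) / (1 - ρ))) :
    (∀ a ∈ ({Action.R, Action.N, Action.H} : Set Action),
      Monotone (fun q : ℤ => Qval c lam rH rN γ Etau Etau2 P V q cog Action.S - Qval c lam rH rN γ Etau Etau2 P V q cog a)) ∧
    ∀ q₁ q₂ : ℤ, q₁ ≤ q₂ →
      (∀ a ∈ ({Action.R, Action.N, Action.H} : Set Action),
        Qval c lam rH rN γ Etau Etau2 P V q₁ cog a < Qval c lam rH rN γ Etau Etau2 P V q₁ cog Action.S) →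
      (∀ a ∈ ({Action.R, Action.N, Action.H} : Set Action),
        Qval c lam rH rN γ Etau Etau2 P V q₂ cog a < Qval c lam rH rN γ Etau Etau2 P V q₂ cog Action.S) := by
  obtain ⟨hγ₀, hγ₁⟩ := hγ
  obtain ⟨hRs, hRN, hNH⟩ := hord
  simp only [tsum_fintype] at hPsum hEtau hMom2
  have hmem (a : Action) : a ∈ Act cogStar cog := by
    rw [Act, if_neg hcog.not_ge]
    cases a <;> simp
  have hm (a : Action) (τ : ℕ) : 0 ≤ ∑ cog', P cog a τ cog' :=
    Finset.sum_nonneg fun cog' _ => hPnn cog a τ cog'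
  have h0 (a : Action) : HasSum (fun τ => ∑ cog', P cog a τ cog') 1 := by
    have h1 := hPsum cog a (hmem a)
    have hs : Summable fun τ => ∑ cog', P cog a τ cog' := by
      by_contra h
      simp [tsum_eq_zero_of_not_summable h] at h1
    exact h1 ▸ hs.hasSum
  have h1 (a : Action) : HasSum (fun τ : ℕ => (τ : ℝ) * ∑ cog', P cog a τ cog') (Etau cog a) := by
    have hs : Summable fun τ : ℕ => (τ : ℝ) * ∑ cog', P cog a τ cog' := by
      refine Summable.of_nonneg_of_le (fun τ => mul_nonneg τ.cast_nonneg (hm a τ)) (fun τ => ?_)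
        (hMom2 cog a)
      refine mul_le_mul_of_nonneg_right ?_ (hm a τ)
      exact_mod_cast Nat.le_self_pow two_ne_zero τ
    rw [hEtau]
    simp only [← Finset.mul_sum]
    exact hs.hasSum
  have hS (φ : ℕ → ℝ) : HasSum (fun τ => φ τ * ∑ cog', P cog Action.S τ cog') (φ ts) := by
    have h := (h0 Action.S).mul_left (φ ts)
    rw [mul_one] at h
    refine h.congr_fun fun τ => ?_
    by_cases hτ : τ = ts
    · rw [hτ]
    · simp [hPS cog τ _ hτ]
  have hES : Etau cog Action.S = ts := (h1 Action.S).unique (hS fun τ => (τ : ℝ))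
  have hden : 0 < 1 - γ ^ tmax :=
    sub_pos.2 (pow_lt_one₀ hγ₀.le hγ₁ (Nat.one_le_iff_ne_zero.1 htmax))
  have hmono : ∀ a ∈ ({Action.R, Action.N, Action.H} : Set Action),
      Monotone (fun q : ℤ => Qval c lam rH rN γ Etau Etau2 P V q cog Action.S -
        Qval c lam rH rN γ Etau Etau2 P V q cog a) := by
    intro a ha q q' hq
    obtain ⟨Δ, rfl⟩ := Int.le.dest hq
    have hEa : Etau cog Action.R ≤ Etau cog a ∧ Etau cog a ≤ Etau cog Action.H := by
      rcases ha with rfl | rfl | rfl <;> constructor <;> linarith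
    have hJ : γ ^ Etau cog Action.H ≤ ∑' τ, γ ^ τ * ∑ cog', P cog a τ cog' :=
      (Real.rpow_le_rpow_of_exponent_ge hγ₀ hγ₁.le hEa.2).trans
        (rpow_mean_le_tsum hγ₀ hγ₁.le (hm a) (h0 a) (h1 a))
    have hbound (b : Action) := Qval_sub_bounds (rH := rH) (rN := rN) (Etau := Etau)
      (Etau2 := Etau2) hV hc.le hlam.le hγ₀.le hγ₁.le (hPnn cog b) (h0 b).summable
      (h1 b).summable q Δ
    have hbS := (hbound Action.S).2
    rw [(hS fun τ => γ ^ τ).tsum_eq, hES] at hbS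
    have hcoef : 0 ≤ c * ts * Δ / (1 - γ ^ tmax) := by positivity
    have hba := (add_le_add_right (mul_le_mul_of_nonneg_left hJ hcoef) _).trans (hbound a).1
    have hcΔ : 0 ≤ c * (Δ : ℝ) := by positivity
    have hkey := mul_le_mul_of_nonneg_left (hcond.le.trans
      (add_le_add_left (sub_le_sub_right hEa.1 _) _)) hcΔ
    have hgoal : c * ts * Δ + c * tmax * Δ / (1 - ρ) * γ ^ ts ≤
        c * Etau cog a * Δ + c * ts * Δ / (1 - γ ^ tmax) * γ ^ Etau cog Action.H := by
      ring_nf at hkey ⊢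
      linarith
    show _ - _ ≤ _ - _
    linarith
  refine ⟨hmono, fun q₁ q₂ hq h a ha => ?_⟩
  have h12 : _ - _ ≤ _ - _ := hmono a ha hq
  linarith [h a ha]

end Fidelity
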